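/- (Main theorem) Let c(x,y)=|x−y|², μ absolutely continuous with respect to Lebesgue measure, and ∫|x|²dμ + ∫|y|²dν < ∞. Let γ be a metric on P(ℝ^d) metrizing the weak topology, εₙ → 0, λₙ → ∞, and Tₙ be εₙ-minimizers of M_{λₙ}(T) = ∫|x−T(x)|²dμ + λₙγ²(μ∘T⁻¹,ν). Then lim_n M_{λₙ}(Tₙ) = M(T*) = W₂²(μ,ν), where T* is the unique optimal transport map, and μ∘Tₙ⁻¹ converges weakly to ν. -/

import Mathlib

open MeasureTheory Filter Topology BoundedContinuousFunction
open scoped ENNReal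

/-- `γ` is a metric on the set of Borel probability measures on `ℝ^d`. -/
def IsProbMetric {d : ℕ}
    (γ : Measure (EuclideanSpace ℝ (Fin d)) → Measure (EuclideanSpace ℝ (Fin d)) → ℝ) : Prop :=
  (∀ μ ν, IsProbabilityMeasure μ → IsProbabilityMeasure ν → 0 ≤ γ μ ν) ∧
  (∀ μ ν, IsProbabilityMeasure μ → IsProbabilityMeasure ν → γ μ ν = γ ν μ) ∧
  (∀ μ ν, IsProbabilityMeasure μ → IsProbabilityMeasure ν → (γ μ ν = 0 ↔ μ = ν)) ∧
  (∀ μ ν ρ, IsProbabilityMeasure μ → IsProbabilityMeasure ν → IsProbabilityMeasure ρ →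
    γ μ ρ ≤ γ μ ν + γ ν ρ)

/-- The squared 2-Wasserstein distance, defined as the infimum of `∬|x−y|² dπ` over all
couplings `π` of `μ` and `ν`. -/
noncomputable def W2sq {d : ℕ} (μ ν : Measure (EuclideanSpace ℝ (Fin d))) : ℝ≥0∞ :=
  ⨅ π : {π : Measure (EuclideanSpace ℝ (Fin d) × EuclideanSpace ℝ (Fin d)) //
      π.map Prod.fst = μ ∧ π.map Prod.snd = ν},
    ∫⁻ p, ENNReal.ofReal (‖p.1 - p.2‖ ^ 2) ∂π.1


section Helpers

open ProbabilityTheory Set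

/-- Probability integral transform for an atomless measure on `ℝ`. -/
lemma exists_map_uniform_real (m : Measure ℝ) [IsProbabilityMeasure m] [NullSingletonClass m] :
    ∃ F : ℝ → unitInterval, Measurable F ∧ m.map F = volume := by
  have hmono : Monotone (cdf m) := monotone_cdf m
  have hcont : Continuous (cdf m) := by
    rw [continuous_iff_continuousAt]
    intro x
    rw [hmono.continuousAt_iff_leftLim_eq_rightLim, StieltjesFunction.rightLim_eq]
    have h := (cdf m).measure_singleton x
    rw [measure_cdf, measure_singleton] at h
    have h1 := ENNReal.ofReal_eq_zero.1 h.symm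
    have h2 := hmono.leftLim_le (le_refl x)
    linarith
  have hsurj : ∀ t : ℝ, 0 < t → t < 1 → ∃ x, cdf m x = t := by
    intro t h0 h1
    obtain ⟨a, ha⟩ := ((tendsto_cdf_atBot m).eventually (gt_mem_nhds h0)).exists
    obtain ⟨b, hb⟩ := ((tendsto_cdf_atTop m).eventually (lt_mem_nhds h1)).exists
    exact mem_range_of_exists_le_of_exists_ge hcont ⟨a, ha.le⟩ ⟨b, hb.le⟩
  have hup : ∀ t : ℝ, 0 ≤ t → m {x | cdf m x ≤ t} ≤ ENNReal.ofReal t := by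
    intro t h0
    by_cases h1 : 1 ≤ t
    · exact prob_le_one.trans (by simpa using h1)
    push Not at h1
    have hlim : Tendsto (fun s : ℝ => ENNReal.ofReal s) (𝓝[>] t) (𝓝 (ENNReal.ofReal t)) :=
      (ENNReal.continuous_ofReal.tendsto t).mono_left nhdsWithin_le_nhds
    refine ge_of_tendsto hlim ?_
    filter_upwards [Ioo_mem_nhdsGT h1] with s hs
    obtain ⟨x, hx⟩ := hsurj s (h0.trans_lt hs.1) hs.2
    rw [← hx, ofReal_cdf]
    apply measure_mono
    intro y hy
    by_contra hxy
    have := hmono (not_le.1 hxy).le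
    rw [hx] at this
    exact absurd (this.trans hy) (not_le.2 hs.1)
  have hlow : ∀ t : ℝ, 0 ≤ t → t ≤ 1 → ENNReal.ofReal t ≤ m {x | cdf m x ≤ t} := by
    intro t h0 h1
    rcases h0.eq_or_lt with rfl | h0
    · simp
    rcases h1.eq_or_lt with rfl | h1
    · simp [cdf_le_one]
    obtain ⟨x, hx⟩ := hsurj t h0 h1
    conv_lhs => rw [← hx, ofReal_cdf]
    apply measure_mono
    intro y hy
    exact (hmono hy).trans hx.le
  let F : ℝ → unitInterval := fun x => ⟨cdf m x, cdf_nonneg m x, cdf_le_one m x⟩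
  have hF : Measurable F := (hcont.subtype_mk _).measurable
  have : IsProbabilityMeasure (m.map F) := Measure.isProbabilityMeasure_map hF.aemeasurable
  refine ⟨F, hF, Measure.ext_of_Iic _ _ fun t => ?_⟩
  rw [Measure.map_apply hF measurableSet_Iic, unitInterval.volume_Iic]
  exact le_antisymm (hup t t.2.1) (hlow t t.2.1 t.2.2)

lemma exists_map_eq_prob {E : Type*} [MeasurableSpace E] [StandardBorelSpace E]
    (m n : Measure E) [IsProbabilityMeasure m] [IsProbabilityMeasure n] [NullSingletonClass m] :
    ∃ S : E → E, Measurable S ∧ m.map S = n := by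
  have hφ := measurableEmbedding_embeddingReal E
  have : Nonempty E := nonempty_of_isProbabilityMeasure m
  have : IsProbabilityMeasure (m.map (embeddingReal E)) :=
    Measure.isProbabilityMeasure_map hφ.measurable.aemeasurable
  have : NullSingletonClass (m.map (embeddingReal E)) := by
    refine ⟨fun x => ?_⟩
    rw [hφ.map_apply]
    exact (subsingleton_singleton.preimage hφ.injective).measure_zero m
  obtain ⟨F, hF, hFm⟩ := exists_map_uniform_real (m.map (embeddingReal E))
  obtain ⟨g, hg, hgm⟩ := n.exists_measurable_map_eq
  refine ⟨g ∘ F ∘ embeddingReal E, hg.comp (hF.comp hφ.measurable), ?_⟩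
  rw [← Measure.map_map hg (hF.comp hφ.measurable), ← Measure.map_map hF hφ.measurable, hFm, hgm]

lemma exists_map_eq_finite {E : Type*} [MeasurableSpace E] [StandardBorelSpace E]
    (m n : Measure E) [IsFiniteMeasure m] [NullSingletonClass m] (hmn : m univ = n univ) :
    ∃ S : E → E, Measurable S ∧ m.map S = n := by
  by_cases h0 : m univ = 0
  · refine ⟨id, measurable_id, ?_⟩
    have h1 : n univ = 0 := hmn ▸ h0
    rw [Measure.map_id, Measure.measure_univ_eq_zero.1 h0, Measure.measure_univ_eq_zero.1 h1]
  have htop : m univ ≠ ∞ := measure_ne_top m _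
  have hc : m univ * (m univ)⁻¹ = 1 := ENNReal.mul_inv_cancel h0 htop
  have hc' : (m univ)⁻¹ * m univ = 1 := by rw [mul_comm, hc]
  have : IsProbabilityMeasure ((m univ)⁻¹ • m) := ⟨by simp [hc']⟩
  have : IsProbabilityMeasure ((m univ)⁻¹ • n) := ⟨by simp [← hmn, hc']⟩
  have : NullSingletonClass ((m univ)⁻¹ • m) := ⟨fun x => by simp⟩
  obtain ⟨S, hS, h⟩ := exists_map_eq_prob ((m univ)⁻¹ • m) ((m univ)⁻¹ • n)
  refine ⟨S, hS, ?_⟩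
  rw [Measure.map_smul] at h
  have := congrArg (fun q => (m univ) • q) h
  simpa [smul_smul, hc] using this

lemma exists_map_partition {E : Type*} [MeasurableSpace E] [StandardBorelSpace E]
    (μ : Measure E) [IsProbabilityMeasure μ] [NullSingletonClass μ] (π : Measure (E × E))
    (hπ : π.map Prod.fst = μ) (i : E → ℕ) (hi : Measurable i) :
    ∃ S : E → E, Measurable S ∧ ∀ f : ℕ × E → ℝ≥0∞, Measurable f →
      ∫⁻ x, f (i x, S x) ∂μ = ∫⁻ p, f (i p.1, p.2) ∂π := by
  have hA : ∀ n, MeasurableSet (i ⁻¹' {n}) := fun n => hi (measurableSet_singleton n)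
  have hB : ∀ n, MeasurableSet (Prod.fst ⁻¹' (i ⁻¹' {n}) : Set (E × E)) :=
    fun n => measurable_fst (hA n)
  have key : ∀ n, ∃ S : E → E, Measurable S ∧
      (μ.restrict (i ⁻¹' {n})).map S =
        (π.restrict (Prod.fst ⁻¹' (i ⁻¹' {n}))).map Prod.snd := by
    intro n
    apply exists_map_eq_finite
    rw [Measure.map_apply measurable_snd MeasurableSet.univ, Measure.restrict_apply_univ,
      preimage_univ, Measure.restrict_apply_univ, ← hπ, Measure.map_apply measurable_fst (hA n)]
  choose S hS hSm using key
  have hSS : Measurable (fun x => S (i x) x) := by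
    have : Measurable (fun p : ℕ × E => S p.1 p.2) :=
      measurable_from_prod_countable_right (fun n => hS n)
    exact this.comp (hi.prodMk measurable_id)
  refine ⟨fun x => S (i x) x, hSS, fun f hf => ?_⟩
  have hd : Pairwise (Function.onFun Disjoint fun n => i ⁻¹' {n}) := by
    intro a b hab
    exact Disjoint.preimage _ (by simpa using hab)
  have hu : (⋃ n, i ⁻¹' {n}) = univ := by ext; simp
  have hd2 : Pairwise (Function.onFun Disjoint
      fun n => (Prod.fst ⁻¹' (i ⁻¹' {n}) : Set (E × E))) := by
    intro a b hab
    exact Disjoint.preimage _ (hd hab)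
  have hu2 : (⋃ n, (Prod.fst ⁻¹' (i ⁻¹' {n}) : Set (E × E))) = univ := by ext; simp
  rw [← setLIntegral_univ, ← hu, lintegral_iUnion hA hd, ← setLIntegral_univ (μ := π), ← hu2,
    lintegral_iUnion hB hd2]
  congr 1
  ext n
  have hfn : Measurable (fun y => f (n, y)) := hf.comp (by fun_prop)
  calc ∫⁻ x in i ⁻¹' {n}, f (i x, S (i x) x) ∂μ
      = ∫⁻ x in i ⁻¹' {n}, f (n, S n x) ∂μ := by
        apply setLIntegral_congr_fun (hA n)
        intro x hx
        have : i x = n := hx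
        simp [this]
    _ = ∫⁻ y, f (n, y) ∂((μ.restrict (i ⁻¹' {n})).map (S n)) :=
        (lintegral_map hfn (hS n)).symm
    _ = ∫⁻ p in Prod.fst ⁻¹' (i ⁻¹' {n}), f (n, p.2) ∂π := by
        rw [hSm, lintegral_map hfn measurable_snd]
    _ = _ := by
        apply setLIntegral_congr_fun (hB n)
        intro x hx
        have : i x.1 = n := hx
        simp [this]

lemma exists_map_approx {E : Type*} [NormedAddCommGroup E] [MeasurableSpace E] [BorelSpace E]
    [CompleteSpace E] [SecondCountableTopology E]
    (μ ν : Measure E) [IsProbabilityMeasure μ] [NullSingletonClass μ] (π : Measure (E × E))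
    (hπ : π.map Prod.fst = μ) (hπ2 : π.map Prod.snd = ν) (δ : ℝ) (hδ : 0 < δ) :
    ∃ S : E → E, Measurable S ∧ μ.map S = ν ∧
      ∫⁻ x, ENNReal.ofReal (‖x - S x‖ ^ 2) ∂μ ≤
        ENNReal.ofReal (1 + 2 * δ) * ∫⁻ p, ENNReal.ofReal (‖p.1 - p.2‖ ^ 2) ∂π
          + ENNReal.ofReal (4 * δ ^ 2 + 2 * δ) := by
  classical
  let q : ℕ → E := TopologicalSpace.denseSeq E
  have hex : ∀ x, ∃ n, ‖x - q n‖ < δ := by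
    intro x
    obtain ⟨n, hn⟩ := Metric.denseRange_iff.1 (TopologicalSpace.denseRange_denseSeq E) x δ hδ
    exact ⟨n, by simpa [dist_eq_norm] using hn⟩
  let i : E → ℕ := fun x => Nat.find (hex x)
  have hi : Measurable i := measurable_find hex fun n =>
    measurableSet_lt (by fun_prop) measurable_const
  have hiq : ∀ x, ‖x - q (i x)‖ < δ := fun x => Nat.find_spec (hex x)
  obtain ⟨S, hS, hSf⟩ := exists_map_partition μ π hπ i hi
  have : IsProbabilityMeasure π := ⟨by
    have : μ univ = 1 := measure_univ
    rwa [← hπ, Measure.map_apply measurable_fst MeasurableSet.univ, preimage_univ] at this⟩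
  refine ⟨S, hS, ?_, ?_⟩
  · ext B hB
    have := hSf (fun p => B.indicator 1 p.2) ((measurable_one.indicator hB).comp measurable_snd)
    rw [← hπ2, Measure.map_apply hS hB, Measure.map_apply measurable_snd hB]
    simp only at this
    rw [← lintegral_indicator_one (hS hB), ← lintegral_indicator_one (measurable_snd hB)]
    exact this
  · have hf : Measurable (fun p : ℕ × E => ENNReal.ofReal ((‖q p.1 - p.2‖ + δ) ^ 2)) := by
      have hq : Measurable q := measurable_from_nat
      fun_prop
    calc ∫⁻ x, ENNReal.ofReal (‖x - S x‖ ^ 2) ∂μ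
        ≤ ∫⁻ x, ENNReal.ofReal ((‖q (i x) - S x‖ + δ) ^ 2) ∂μ := by
          apply lintegral_mono
          intro x
          apply ENNReal.ofReal_le_ofReal
          gcongr
          have := norm_sub_le_norm_sub_add_norm_sub x (q (i x)) (S x)
          linarith [hiq x]
      _ = ∫⁻ p, ENNReal.ofReal ((‖q (i p.1) - p.2‖ + δ) ^ 2) ∂π := hSf _ hf
      _ ≤ ∫⁻ p, (ENNReal.ofReal (1 + 2 * δ) * ENNReal.ofReal (‖p.1 - p.2‖ ^ 2)
            + ENNReal.ofReal (4 * δ ^ 2 + 2 * δ)) ∂π := by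
          apply lintegral_mono
          intro p
          dsimp only
          rw [← ENNReal.ofReal_mul (by positivity), ← ENNReal.ofReal_add (by positivity)
            (by positivity)]
          apply ENNReal.ofReal_le_ofReal
          have h1 := norm_sub_le_norm_sub_add_norm_sub (q (i p.1)) p.1 p.2
          rw [norm_sub_rev (q (i p.1)) p.1] at h1
          have h2 := hiq p.1
          have h3 : ‖q (i p.1) - p.2‖ + δ ≤ ‖p.1 - p.2‖ + 2 * δ := by linarith
          calc (‖q (i p.1) - p.2‖ + δ) ^ 2 ≤ (‖p.1 - p.2‖ + 2 * δ) ^ 2 := by gcongr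
            _ ≤ _ := by nlinarith [mul_nonneg hδ.le (sq_nonneg (‖p.1 - p.2‖ - 1))]
      _ = _ := by
          rw [lintegral_add_right _ measurable_const, lintegral_const_mul _ (by fun_prop)]
          simp

lemma monge_le_of_coupling {E : Type*} [NormedAddCommGroup E] [MeasurableSpace E] [BorelSpace E]
    [CompleteSpace E] [SecondCountableTopology E]
    (μ ν : Measure E) [IsProbabilityMeasure μ] [NullSingletonClass μ] (π : Measure (E × E))
    (hπ : π.map Prod.fst = μ) (hπ2 : π.map Prod.snd = ν) (c : ℝ≥0∞)
    (hc : ∀ S : E → E, Measurable S → μ.map S = ν →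
      c ≤ ∫⁻ x, ENNReal.ofReal (‖x - S x‖ ^ 2) ∂μ) :
    c ≤ ∫⁻ p, ENNReal.ofReal (‖p.1 - p.2‖ ^ 2) ∂π := by
  set C := ∫⁻ p, ENNReal.ofReal (‖p.1 - p.2‖ ^ 2) ∂π with hC
  by_cases hCt : C = ∞
  · simp [hCt]
  have h : ∀ δ : ℝ, 0 < δ →
      c ≤ ENNReal.ofReal (1 + 2 * δ) * C + ENNReal.ofReal (4 * δ ^ 2 + 2 * δ) := by
    intro δ hδ
    obtain ⟨S, hS, hm, hle⟩ := exists_map_approx μ ν π hπ hπ2 δ hδ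
    exact (hc S hS hm).trans hle
  have hlim : Tendsto (fun δ : ℝ =>
      ENNReal.ofReal (1 + 2 * δ) * C + ENNReal.ofReal (4 * δ ^ 2 + 2 * δ)) (𝓝[>] 0) (𝓝 C) := by
    have h1 : Tendsto (fun δ : ℝ => ENNReal.ofReal (1 + 2 * δ)) (𝓝 0) (𝓝 1) := by
      have : Continuous (fun δ : ℝ => ENNReal.ofReal (1 + 2 * δ)) :=
        ENNReal.continuous_ofReal.comp (by fun_prop)
      simpa using this.tendsto 0
    have h2 : Tendsto (fun δ : ℝ => ENNReal.ofReal (4 * δ ^ 2 + 2 * δ)) (𝓝 0) (𝓝 0) := by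
      have : Continuous (fun δ : ℝ => ENNReal.ofReal (4 * δ ^ 2 + 2 * δ)) :=
        ENNReal.continuous_ofReal.comp (by fun_prop)
      simpa using this.tendsto 0
    have := (ENNReal.Tendsto.mul_const (b := C) h1 (Or.inr hCt)).add h2
    rw [one_mul, add_zero] at this
    exact this.mono_left nhdsWithin_le_nhds
  exact ge_of_tendsto hlim (eventually_mem_nhdsWithin.mono fun δ hδ => h δ hδ)

end Helpers

section Lsc

/-- Lower semicontinuity of the transport cost along graphs of maps, for an ultrafilter. -/
lemma W2sq_le_of_tendsto {d : ℕ} (μ ν : Measure (EuclideanSpace ℝ (Fin d)))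
    [IsProbabilityMeasure μ] [IsProbabilityMeasure ν]
    (T : ℕ → EuclideanSpace ℝ (Fin d) → EuclideanSpace ℝ (Fin d))
    (hT : ∀ n, Measurable (T n))
    (hw : ∀ f : EuclideanSpace ℝ (Fin d) →ᵇ ℝ,
        Tendsto (fun n => ∫ x, f x ∂(μ.map (T n))) atTop (𝓝 (∫ x, f x ∂ν)))
    (U : Ultrafilter ℕ) (hU : (U : Filter ℕ) ≤ atTop) (L : ℝ≥0∞)
    (hL : Tendsto (fun n => ∫⁻ x, ENNReal.ofReal (‖x - T n x‖ ^ 2) ∂μ) U (𝓝 L)) :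
    W2sq μ ν ≤ L := by
  let E := EuclideanSpace ℝ (Fin d)
  have hg : ∀ n, Measurable (fun x => (x, T n x)) := fun n => measurable_id.prodMk (hT n)
  let ρ : ℕ → ProbabilityMeasure E := fun n =>
    ⟨μ.map (T n), Measure.isProbabilityMeasure_map (hT n).aemeasurable⟩
  let ν' : ProbabilityMeasure E := ⟨ν, inferInstance⟩
  let P : ℕ → ProbabilityMeasure (E × E) := fun n =>
    ⟨μ.map (fun x => (x, T n x)), Measure.isProbabilityMeasure_map (hg n).aemeasurable⟩
  have hρ : Tendsto ρ atTop (𝓝 ν') :=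
    ProbabilityMeasure.tendsto_iff_forall_integral_tendsto.2 hw
  have hP1 : ∀ n, (P n : Measure (E × E)).map Prod.fst = μ := by
    intro n
    change (μ.map _).map _ = _
    rw [Measure.map_map measurable_fst (hg n)]
    exact Measure.map_id
  have hP2 : ∀ n, (P n : Measure (E × E)).map Prod.snd = μ.map (T n) := by
    intro n
    change (μ.map _).map _ = _
    rw [Measure.map_map measurable_snd (hg n)]
    rfl
  have htρ : IsTightMeasureSet {((m : ProbabilityMeasure E) : Measure E) | m ∈
      insert ν' (Set.range ρ)} := by
    apply isTightMeasureSet_of_isCompact_closure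
    have := hρ.isCompact_insert_range
    rwa [this.isClosed.closure_eq]
  have htP : IsTightMeasureSet {((m : ProbabilityMeasure (E × E)) : Measure (E × E)) | m ∈
      Set.range P} := by
    apply IsTightMeasureSet.prodMk
    · refine (isTightMeasureSet_singleton (μ := μ)).subset ?_
      rintro _ ⟨_, ⟨_, ⟨n, rfl⟩, rfl⟩, rfl⟩
      exact hP1 n
    · refine htρ.subset ?_
      rintro _ ⟨_, ⟨_, ⟨n, rfl⟩, rfl⟩, rfl⟩
      exact ⟨ρ n, Or.inr ⟨n, rfl⟩, (hP2 n).symm⟩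
  have hcomp := isCompact_closure_of_isTightMeasureSet htP
  obtain ⟨Q, -, hQ⟩ := hcomp.ultrafilter_le_nhds (U.map P) (by
    rw [le_principal_iff]
    exact Filter.mem_map.2 (Filter.univ_mem' fun n => subset_closure ⟨n, rfl⟩))
  have hQ : Tendsto P U (𝓝 Q) := hQ
  have hQ1 : (Q : Measure (E × E)).map Prod.fst = μ := by
    have h1 := ProbabilityMeasure.tendsto_map_of_tendsto_of_continuous P Q hQ
      (continuous_fst : Continuous (Prod.fst : E × E → E))
    have h2 : (fun n => (P n).map
        ((continuous_fst : Continuous (Prod.fst : E × E → E)).measurable.aemeasurable)) =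
        fun _ => (⟨μ, inferInstance⟩ : ProbabilityMeasure E) := by
      funext n
      exact Subtype.ext (hP1 n)
    rw [h2] at h1
    have h3 := tendsto_nhds_unique h1 tendsto_const_nhds
    exact congrArg (fun m : ProbabilityMeasure E => (m : Measure E)) h3
  have hQ2 : (Q : Measure (E × E)).map Prod.snd = ν := by
    have h1 := ProbabilityMeasure.tendsto_map_of_tendsto_of_continuous P Q hQ
      (continuous_snd : Continuous (Prod.snd : E × E → E))
    have h2 : (fun n => (P n).map
        ((continuous_snd : Continuous (Prod.snd : E × E → E)).measurable.aemeasurable)) = ρ := by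
      funext n
      exact Subtype.ext (hP2 n)
    rw [h2] at h1
    have h3 := tendsto_nhds_unique h1 (hρ.mono_left hU)
    exact congrArg (fun m : ProbabilityMeasure E => (m : Measure E)) h3
  refine (iInf_le _ ⟨(Q : Measure (E × E)), hQ1, hQ2⟩).trans ?_
  -- truncations
  let c : ℕ → E × E → NNReal := fun k p => min (‖p.1 - p.2‖₊ ^ 2) k
  have hcc : ∀ k, Continuous (c k) := fun k => by fun_prop
  let cb : ℕ → (E × E →ᵇ NNReal) := fun k =>
    BoundedContinuousFunction.mkOfBound ⟨c k, hcc k⟩ k (by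
      intro x y
      rw [NNReal.dist_eq]
      have h1 : ((c k x : NNReal) : ℝ) ≤ k := by exact_mod_cast min_le_right _ _
      have h2 : ((c k y : NNReal) : ℝ) ≤ k := by exact_mod_cast min_le_right _ _
      have h3 := (c k x).coe_nonneg
      have h4 := (c k y).coe_nonneg
      rw [abs_le]
      change -(k : ℝ) ≤ (c k x : ℝ) - c k y ∧ (c k x : ℝ) - c k y ≤ k
      constructor <;> linarith)
  have hof : ∀ x y : E, ENNReal.ofReal (‖x - y‖ ^ 2) = ((‖x - y‖₊ ^ 2 : NNReal) : ℝ≥0∞) := by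
    intro x y
    rw [← ENNReal.ofReal_coe_nnreal, NNReal.coe_pow, coe_nnnorm]
  have hk : ∀ k, ∫⁻ p, (c k p : ℝ≥0∞) ∂(Q : Measure (E × E)) ≤ L := by
    intro k
    have h1 := ProbabilityMeasure.tendsto_iff_forall_lintegral_tendsto.1 hQ (cb k)
    refine le_of_tendsto_of_tendsto' h1 hL fun n => ?_
    change ∫⁻ p, (c k p : ℝ≥0∞) ∂(μ.map _) ≤ _
    rw [lintegral_map (hcc k).measurable.coe_nnreal_ennreal (hg n)]
    apply lintegral_mono
    intro x
    dsimp only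
    rw [hof]
    exact ENNReal.coe_le_coe.2 (min_le_left _ _)
  have hsup : ∀ p : E × E, ENNReal.ofReal (‖p.1 - p.2‖ ^ 2) = ⨆ k, (c k p : ℝ≥0∞) := by
    intro p
    rw [hof]
    apply le_antisymm
    · obtain ⟨k, hk⟩ := exists_nat_ge (‖p.1 - p.2‖₊ ^ 2)
      refine le_iSup_of_le k ?_
      exact ENNReal.coe_le_coe.2 (le_min le_rfl hk)
    · exact iSup_le fun k => ENNReal.coe_le_coe.2 (min_le_left _ _)
  change ∫⁻ p, ENNReal.ofReal (‖p.1 - p.2‖ ^ 2) ∂(Q : Measure (E × E)) ≤ L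
  simp_rw [hsup]
  rw [lintegral_iSup (fun k => (hcc k).measurable.coe_nnreal_ennreal)]
  · exact iSup_le hk
  · intro a b hab p
    exact ENNReal.coe_le_coe.2 (min_le_min le_rfl (by exact_mod_cast hab))

end Lsc

/-- (Main theorem.) Let `c(x,y)=|x−y|²`, `μ ≪ Leb`, `μ, ν` with finite second moments, `γ` a
metric on probability measures metrizing the weak topology, `εₙ → 0`, `λₙ → ∞`, and `Tₙ` be
`εₙ`-minimizers of `M_{λₙ}(T) = ∫|x−T(x)|²dμ + λₙγ²(μ∘T⁻¹,ν)`. Then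
`lim_n M_{λₙ}(Tₙ) = M(T*) = W₂²(μ,ν)`, where `T*` is the unique optimal transport map, and
`μ∘Tₙ⁻¹` converges weakly to `ν`. -/
theorem stmt10 {d : ℕ} (μ ν : Measure (EuclideanSpace ℝ (Fin d)))
    [IsProbabilityMeasure μ] [IsProbabilityMeasure ν]
    (hmomμ : Integrable (fun x => ‖x‖ ^ 2) μ) (hmomν : Integrable (fun y => ‖y‖ ^ 2) ν)
    (hac : μ ≪ volume)
    (γ : Measure (EuclideanSpace ℝ (Fin d)) → Measure (EuclideanSpace ℝ (Fin d)) → ℝ)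
    (hγ : IsProbMetric γ)
    (hmetr : ∀ (ρ : ℕ → Measure (EuclideanSpace ℝ (Fin d)))
      (ρlim : Measure (EuclideanSpace ℝ (Fin d))),
      (∀ n, IsProbabilityMeasure (ρ n)) → IsProbabilityMeasure ρlim →
      (Tendsto (fun n => γ (ρ n) ρlim) atTop (𝓝 0) ↔
        ∀ f : EuclideanSpace ℝ (Fin d) →ᵇ ℝ,
          Tendsto (fun n => ∫ x, f x ∂(ρ n)) atTop (𝓝 (∫ x, f x ∂ρlim))))
    (Mc : (EuclideanSpace ℝ (Fin d) → EuclideanSpace ℝ (Fin d)) → ℝ≥0∞)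
    (hMc : ∀ T, Mc T = ∫⁻ x, ENNReal.ofReal (‖x - T x‖ ^ 2) ∂μ)
    (Mlam : ℝ → (EuclideanSpace ℝ (Fin d) → EuclideanSpace ℝ (Fin d)) → ℝ≥0∞)
    (hMlam : ∀ lam T, Mlam lam T = Mc T + ENNReal.ofReal (lam * (γ (μ.map T) ν) ^ 2))
    (ε lam : ℕ → ℝ) (hεpos : ∀ n, 0 < ε n) (hlampos : ∀ n, 0 < lam n)
    (hε : Tendsto ε atTop (𝓝 0)) (hlam : Tendsto lam atTop atTop)
    (T : ℕ → EuclideanSpace ℝ (Fin d) → EuclideanSpace ℝ (Fin d))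
    (hTmeas : ∀ n, Measurable (T n))
    (hTmin : ∀ n, Mlam (lam n) (T n) - ENNReal.ofReal (ε n) ≤
      ⨅ S : {S : EuclideanSpace ℝ (Fin d) → EuclideanSpace ℝ (Fin d) // Measurable S},
        Mlam (lam n) S.1)
    -- `T*` is the (unique) optimal transport map from `μ` to `ν` for quadratic cost
    (Tstar : EuclideanSpace ℝ (Fin d) → EuclideanSpace ℝ (Fin d))
    (hTstar : Measurable Tstar) (hpush : μ.map Tstar = ν)
    (hopt : ∀ S : EuclideanSpace ℝ (Fin d) → EuclideanSpace ℝ (Fin d),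
      Measurable S → μ.map S = ν → Mc Tstar ≤ Mc S) :
    Tendsto (fun n => Mlam (lam n) (T n)) atTop (𝓝 (Mc Tstar)) ∧
      Mc Tstar = W2sq μ ν ∧
      ∀ f : EuclideanSpace ℝ (Fin d) →ᵇ ℝ,
        Tendsto (fun n => ∫ x, f x ∂(μ.map (T n))) atTop (𝓝 (∫ x, f x ∂ν)) := by
  obtain ⟨hγ0, -, hγeq, -⟩ := hγ
  have hpr : ∀ n, IsProbabilityMeasure (μ.map (T n)) := fun n =>
    Measure.isProbabilityMeasure_map (hTmeas n).aemeasurable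
  -- Monge = Kantorovich
  have hW1 : W2sq μ ν ≤ Mc Tstar := by
    have hm : Measurable (fun x => (x, Tstar x)) := measurable_id.prodMk hTstar
    have e1 : (μ.map (fun x => (x, Tstar x))).map Prod.fst = μ := by
      rw [Measure.map_map measurable_fst hm]
      exact Measure.map_id
    have e2 : (μ.map (fun x => (x, Tstar x))).map Prod.snd = ν := by
      rw [Measure.map_map measurable_snd hm]
      exact hpush
    refine (iInf_le _ ⟨μ.map (fun x => (x, Tstar x)), e1, e2⟩).trans ?_
    change ∫⁻ p, ENNReal.ofReal (‖p.1 - p.2‖ ^ 2) ∂(μ.map (fun x => (x, Tstar x))) ≤ _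
    rw [hMc, lintegral_map (by fun_prop) hm]
  have hW2 : Mc Tstar ≤ W2sq μ ν := by
    rcases Nat.eq_zero_or_pos d with rfl | hd
    · rw [hMc]
      have : ∀ x, ‖x - Tstar x‖ = 0 := fun x => by
        rw [Subsingleton.elim (x - Tstar x) 0, norm_zero]
      simp [this]
    · have : Nonempty (Fin d) := ⟨⟨0, hd⟩⟩
      have : NullSingletonClass μ := ⟨fun x => hac (measure_singleton x)⟩
      refine le_iInf fun π => ?_
      refine monge_le_of_coupling μ ν π.1 π.2.1 π.2.2 _ fun S hS hSν => ?_
      rw [← hMc]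
      exact hopt S hS hSν
  have hW : Mc Tstar = W2sq μ ν := le_antisymm hW2 hW1
  -- finiteness
  have hfin : Mc Tstar ≠ ∞ := by
    have hmomT : Integrable (fun x => ‖Tstar x‖ ^ 2) μ := by
      rw [← hpush] at hmomν
      exact hmomν.comp_measurable hTstar
    have hint : Integrable (fun x => 2 * ‖x‖ ^ 2 + 2 * ‖Tstar x‖ ^ 2) μ :=
      (hmomμ.const_mul 2).add (hmomT.const_mul 2)
    rw [hMc]
    refine ((lintegral_mono fun x => ENNReal.ofReal_le_ofReal ?_).trans_lt
      hint.lintegral_lt_top).ne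
    have h1 := norm_sub_le x (Tstar x)
    have h2 := norm_nonneg (x - Tstar x)
    nlinarith [sq_nonneg (‖x‖ - ‖Tstar x‖)]
  -- upper bound
  have hup : ∀ n, Mlam (lam n) (T n) ≤ Mc Tstar + ENNReal.ofReal (ε n) := by
    intro n
    have h1 := (hTmin n).trans (iInf_le _ ⟨Tstar, hTstar⟩)
    have h2 : γ ν ν = 0 := (hγeq ν ν inferInstance inferInstance).2 rfl
    rw [tsub_le_iff_right] at h1
    refine h1.trans (le_of_eq ?_)
    dsimp only
    rw [hMlam (lam n) Tstar, hpush, h2]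
    simp
  -- weak convergence
  have hγlim : Tendsto (fun n => γ (μ.map (T n)) ν) atTop (𝓝 0) := by
    have hsq : Tendsto (fun n => (γ (μ.map (T n)) ν) ^ 2) atTop (𝓝 0) := by
      have hlim : Tendsto (fun n => ((Mc Tstar).toReal + ε n) / lam n) atTop (𝓝 0) :=
        (tendsto_const_nhds.add hε).div_atTop hlam
      refine squeeze_zero (fun n => sq_nonneg _) (fun n => ?_) hlim
      rw [le_div_iff₀ (hlampos n), mul_comm]
      have h1 : ENNReal.ofReal (lam n * (γ (μ.map (T n)) ν) ^ 2) ≤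
          ENNReal.ofReal ((Mc Tstar).toReal + ε n) := by
        rw [ENNReal.ofReal_add ENNReal.toReal_nonneg (hεpos n).le, ENNReal.ofReal_toReal hfin]
        refine le_trans ?_ (hup n)
        rw [hMlam]
        exact le_add_self
      exact (ENNReal.ofReal_le_ofReal_iff
        (add_nonneg ENNReal.toReal_nonneg (hεpos n).le)).1 h1
    have := (Real.continuous_sqrt.tendsto 0).comp hsq
    rw [Real.sqrt_zero] at this
    refine this.congr fun n => ?_
    exact Real.sqrt_sq (hγ0 _ _ (hpr n) inferInstance)
  have hweak := (hmetr (fun n => μ.map (T n)) ν hpr inferInstance).1 hγlim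
  refine ⟨?_, hW, hweak⟩
  rw [tendsto_iff_ultrafilter]
  intro U hU
  obtain ⟨L, -, hL⟩ := isCompact_univ.ultrafilter_le_nhds
    (U.map fun n => Mc (T n)) (by simp)
  have hL : Tendsto (fun n => Mc (T n)) U (𝓝 L) := hL
  have hge : Mc Tstar ≤ L := by
    rw [hW]
    refine W2sq_le_of_tendsto μ ν T hTmeas hweak U hU L ?_
    simpa only [hMc] using hL
  have hε' : Tendsto (fun n => Mc Tstar + ENNReal.ofReal (ε n)) U (𝓝 (Mc Tstar)) := by
    have h1 : Tendsto (fun n => ENNReal.ofReal (ε n)) atTop (𝓝 0) := by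
      have h0 := (ENNReal.continuous_ofReal.tendsto 0).comp hε
      rw [ENNReal.ofReal_zero] at h0
      exact h0
    have h2 := (tendsto_const_nhds (x := Mc Tstar)).add h1
    rw [add_zero] at h2
    exact h2.mono_left hU
  have hle1 : ∀ n, Mc (T n) ≤ Mlam (lam n) (T n) := fun n => by
    rw [hMlam]
    exact le_self_add
  have hLeq : L = Mc Tstar := le_antisymm
    (le_of_tendsto_of_tendsto' hL hε' fun n => (hle1 n).trans (hup n)) hge
  rw [hLeq] at hL
  exact tendsto_of_tendsto_of_tendsto_of_le_of_le hL hε' hle1 hup
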